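/- For every 0 < R ≤ 1/3, the sharp constant Λ(R) = Λ_{φ₀}(R) for the function φ₀(f,r) := S_r(f)/(π − S_r(f)) satisfies (2/9)·((1−R²)/R²) ≤ Λ(R) ≤ (1/96)·((81−R²)(3−5R)/(3−R))·((1−R²)/R²). -/

import Mathlib

open Metric

/-- The `n`-th Taylor coefficient of `f` at `0`. -/
noncomputable def taylorCoeff (f : ℂ → ℂ) (n : ℕ) : ℂ :=
  iteratedDeriv n f 0 / n.factorial

/-- The class `𝓑` of holomorphic functions on the unit disc bounded by `1`. -/
def memB (f : ℂ → ℂ) : Prop :=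
  DifferentiableOn ℂ f (ball (0 : ℂ) 1) ∧ ∀ z ∈ ball (0 : ℂ) 1, ‖f z‖ ≤ 1

/-- `Σ_{n≥0} |aₙ| rⁿ`, the Bohr sum of `f` at radius `r`. -/
noncomputable def bohrSum (f : ℂ → ℂ) (r : ℝ) : ℝ :=
  ∑' n : ℕ, ‖taylorCoeff f n‖ * r ^ n

/-- `S_r(f) = π Σ_{n≥1} n |aₙ|² r^{2n}` (the `n = 0` term vanishes, so we may sum over
all of `ℕ`). -/
noncomputable def Sarea (f : ℂ → ℂ) (r : ℝ) : ℝ :=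
  Real.pi * ∑' n : ℕ, (n : ℝ) * ‖taylorCoeff f n‖ ^ 2 * r ^ (2 * n)

/-- `φ₀(f,r) = S_r(f)/(π − S_r(f))`. -/
noncomputable def phi0 (f : ℂ → ℂ) (r : ℝ) : ℝ :=
  Sarea f r / (Real.pi - Sarea f r)

/-- The sharp constant `Λ_φ(R)`. -/
noncomputable def sharpConstant (φ : (ℂ → ℂ) → ℝ → ℝ) (R : ℝ) : ℝ :=
  sSup {l : ℝ | 0 ≤ l ∧
    ∀ f, memB f → ∀ r, 0 ≤ r → r ≤ R → bohrSum f r + l * φ f r ≤ 1}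


open Filter Topology

theorem parseval_summable (c : ℕ → ℂ) (hc : Summable fun n => ‖c n‖) :
    HasSum (fun n => ‖c n‖ ^ 2) (Real.circleAverage (fun w => ‖∑' n, c n * w ^ n‖ ^ 2) 0 1) := by
  rw [hasSum_iff_tendsto_nat_of_nonneg (fun n => by positivity)]
  have key : ∀ N : ℕ, ∑ i ∈ Finset.range N, ‖c i‖ ^ 2 =
      Real.circleAverage (fun w => ‖∑ i ∈ Finset.range N, c i * w ^ i‖ ^ 2) 0 1 := by
    intro N
    have h := Polynomial.sum_sq_norm_coeff_eq_circleAverage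
      (∑ i ∈ Finset.range N, Polynomial.monomial i (c i))
    have hco : ∀ k, (∑ i ∈ Finset.range N, Polynomial.monomial i (c i)).coeff k =
        if k < N then c k else 0 := by
      intro k
      simp [Polynomial.coeff_monomial]
    have hev : ∀ w : ℂ, (∑ i ∈ Finset.range N, Polynomial.monomial i (c i)).eval w =
        ∑ i ∈ Finset.range N, c i * w ^ i := by
      intro w
      simp [Polynomial.eval_finsetSum]
    simp only [hev] at h
    rw [← h]
    symm
    have h1 : ∑ k ∈ Finset.range N, ‖c k‖ ^ 2 = ∑ k ∈ Finset.range N,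
        ‖(∑ i ∈ Finset.range N, Polynomial.monomial i (c i)).coeff k‖ ^ 2 := by
      refine Finset.sum_congr rfl fun k hk => ?_
      rw [hco, if_pos (Finset.mem_range.1 hk)]
    rw [h1]
    refine Finset.sum_subset ?_ ?_
    · intro k hk
      rw [Polynomial.mem_support_iff, hco] at hk
      simp only [ne_eq, ite_eq_right_iff, Classical.not_imp] at hk
      exact Finset.mem_range.2 hk.1
    · intro k _ hk
      rw [Polynomial.notMem_support_iff] at hk
      rw [hk]; simp
  simp_rw [key, Real.circleAverage_def]
  refine Tendsto.const_smul ?_ _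
  have hnorm : ∀ θ : ℝ, ∀ n, ‖c n * circleMap 0 1 θ ^ n‖ = ‖c n‖ := by
    intro θ n; simp
  refine intervalIntegral.tendsto_integral_filter_of_dominated_convergence
    (fun _ => (∑' n, ‖c n‖) ^ 2) ?_ ?_ ?_ ?_
  · refine Eventually.of_forall fun N => ?_
    refine Continuous.aestronglyMeasurable ?_
    fun_prop
  · refine Eventually.of_forall fun N => Eventually.of_forall fun θ _ => ?_
    rw [Real.norm_of_nonneg (by positivity)]
    refine pow_le_pow_left₀ (norm_nonneg _) ?_ 2
    refine (norm_sum_le _ _).trans ?_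
    simp_rw [hnorm]
    exact hc.sum_le_tsum _ (fun _ _ => norm_nonneg _)
  · exact intervalIntegrable_const
  · refine Eventually.of_forall fun θ _ => ?_
    have hs : Summable fun n => c n * circleMap 0 1 θ ^ n :=
      Summable.of_norm (by simpa only [hnorm] using hc)
    exact (hs.hasSum.tendsto_sum_nat.norm).pow 2

theorem circleIntegrable_normsq (c : ℕ → ℂ) (hc : Summable fun n => ‖c n‖) :
    CircleIntegrable (fun w => ‖∑' n, c n * w ^ n‖ ^ 2) 0 1 := by
  refine ContinuousOn.circleIntegrable zero_le_one ?_
  refine (ContinuousOn.norm ?_).pow 2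
  refine continuousOn_tsum (u := fun n => ‖c n‖) (fun n => by fun_prop) hc ?_
  intro n w hw
  have : ‖w‖ = 1 := by simpa using hw
  simp [this]

theorem l2_compare (c d : ℕ → ℂ) (hc : Summable fun n => ‖c n‖) (hd : Summable fun n => ‖d n‖)
    (K : ℝ) (h : ∀ w : ℂ, ‖w‖ = 1 → ‖∑' n, c n * w ^ n‖ ^ 2 ≤ K * ‖∑' n, d n * w ^ n‖ ^ 2) :
    ∑' n, ‖c n‖ ^ 2 ≤ K * ∑' n, ‖d n‖ ^ 2 := by
  rw [(parseval_summable c hc).tsum_eq, (parseval_summable d hd).tsum_eq, ← smul_eq_mul,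
    ← Real.circleAverage_fun_smul]
  refine Real.circleAverage_mono (circleIntegrable_normsq c hc) ?_ ?_
  · exact (circleIntegrable_normsq d hd).const_smul (a := K)
  · intro w hw
    have : ‖w‖ = 1 := by simpa using hw
    simpa using h w this

theorem hasSum_taylorCoeff {f : ℂ → ℂ} (hf : DifferentiableOn ℂ f (ball (0 : ℂ) 1)) {z : ℂ}
    (hz : ‖z‖ < 1) : HasSum (fun n => taylorCoeff f n * z ^ n) (f z) := by
  have h := Complex.hasSum_taylorSeries_on_ball hf (z := z) (by simpa using hz)
  convert! h using 1
  funext n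
  simp only [taylorCoeff, sub_zero, smul_eq_mul]
  ring

theorem summable_taylorCoeff {f : ℂ → ℂ} (hf : DifferentiableOn ℂ f (ball (0 : ℂ) 1)) {s : ℝ}
    (hs0 : 0 ≤ s) (hs : s < 1) : Summable fun n => ‖taylorCoeff f n‖ * s ^ n := by
  have h := (hasSum_taylorCoeff hf (z := (s : ℂ)) (by simpa [abs_of_nonneg hs0] using hs)).summable.norm
  simpa [abs_of_nonneg hs0] using h

theorem taylorCoeff_eq {f : ℂ → ℂ} (hf : DifferentiableOn ℂ f (ball (0 : ℂ) 1)) (c : ℕ → ℂ)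
    (hc : ∀ z : ℂ, ‖z‖ < 1 → HasSum (fun n => c n * z ^ n) (f z)) (n : ℕ) :
    taylorCoeff f n = c n := by
  have gen : ∀ c : ℕ → ℂ, (∀ z : ℂ, ‖z‖ < 1 → HasSum (fun n => c n * z ^ n) (f z)) →
      HasFPowerSeriesAt f (FormalMultilinearSeries.ofScalars ℂ c) 0 := by
    intro c hc
    rw [hasFPowerSeriesAt_iff]
    filter_upwards [ball_mem_nhds (0 : ℂ) one_pos] with z hz
    have := hc z (by simpa using hz)
    simpa [FormalMultilinearSeries.coeff_ofScalars, mul_comm] using this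
  have h := (gen _ hc).eq_formalMultilinearSeries
    (gen (taylorCoeff f) (fun z hz => hasSum_taylorCoeff hf hz))
  have h2 := congrArg (fun p => FormalMultilinearSeries.coeff p n) h
  simpa [FormalMultilinearSeries.coeff_ofScalars] using h2.symm

theorem taylorCoeff_zero (f : ℂ → ℂ) : taylorCoeff f 0 = f 0 := by
  simp [taylorCoeff]

theorem coeff_bound_aux {f : ℂ → ℂ} (hf : memB f) {s : ℝ} (hs0 : 0 ≤ s) (hs : s < 1) {n : ℕ}
    (hn : n ≠ 0) (e : ℂ) :
    ‖taylorCoeff f 0‖ ^ 2 + ‖taylorCoeff f n * s ^ n + e * taylorCoeff f 0‖ ^ 2 ≤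
      1 + ‖e‖ ^ 2 := by
  set b : ℕ → ℂ := fun k => taylorCoeff f k * s ^ k with hb
  have hbs : Summable fun k => ‖b k‖ := by
    simpa [hb, abs_of_nonneg hs0] using summable_taylorCoeff hf.1 hs0 hs
  set sh : ℕ → ℂ := fun k => if n ≤ k then e * b (k - n) else 0 with hsh
  set d : ℕ → ℂ := fun k => (if k = 0 then 1 else 0) + (if k = n then e else 0) with hd
  have hsh_sum : Summable fun k => ‖sh k‖ := by
    rw [← summable_nat_add_iff n]
    simpa [hsh] using hbs.mul_left ‖e‖
  have hcs : Summable fun k => ‖b k + sh k‖ :=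
    Summable.of_nonneg_of_le (fun _ => norm_nonneg _) (fun k => norm_add_le _ _)
      (hbs.add hsh_sum)
  have hds : Summable fun k => ‖d k‖ := by
    refine summable_of_ne_finset_zero (s := {0, n}) fun k hk => ?_
    simp only [Finset.mem_insert, Finset.mem_singleton, not_or] at hk
    simp [hd, hk.1, hk.2]
  have hbw : ∀ w : ℂ, ‖w‖ = 1 → HasSum (fun k => b k * w ^ k) (f (s * w)) := by
    intro w hw
    have := hasSum_taylorCoeff hf.1 (z := s * w) (by simpa [hw, abs_of_nonneg hs0] using hs)
    convert! this using 1
    funext k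
    simp only [hb, mul_pow]; ring
  have hcw : ∀ w : ℂ, ‖w‖ = 1 →
      HasSum (fun k => (b k + sh k) * w ^ k) (f (s * w) * (1 + e * w ^ n)) := by
    intro w hw
    have h1 := hbw w hw
    have h2 : HasSum (fun k => sh k * w ^ k) (f (s * w) * (e * w ^ n)) := by
      rw [← hasSum_nat_add_iff' n]
      have h0 : ∑ i ∈ Finset.range n, sh i * w ^ i = 0 := by
        refine Finset.sum_eq_zero fun i hi => ?_
        have := Finset.mem_range.1 hi
        simp [hsh, this]
      rw [h0, sub_zero]
      convert! h1.mul_right (e * w ^ n) using 1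
      funext k
      simp only [hsh, Nat.le_add_left, if_true, Nat.add_sub_cancel]; ring
    convert! h1.add h2 using 1
    · funext k; ring
    · ring
  have hdw : ∀ w : ℂ, ∑' k, d k * w ^ k = 1 + e * w ^ n := by
    intro w
    rw [tsum_eq_sum (s := {0, n})]
    · rw [Finset.sum_pair hn.symm]
      simp [hd, hn, hn.symm]
    · intro k hk
      simp only [Finset.mem_insert, Finset.mem_singleton, not_or] at hk
      simp [hd, hk.1, hk.2]
  have hmain := l2_compare (fun k => b k + sh k) d hcs hds 1 (by
    intro w hw
    rw [(hcw w hw).tsum_eq, hdw, one_mul, norm_mul]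
    refine pow_le_pow_left₀ (by positivity) ?_ 2
    have := hf.2 (s * w) (by simpa [hw, abs_of_nonneg hs0] using hs)
    exact mul_le_of_le_one_left (norm_nonneg _) this)
  have hd2 : ∑' k, ‖d k‖ ^ 2 = 1 + ‖e‖ ^ 2 := by
    rw [tsum_eq_sum (s := {0, n})]
    · rw [Finset.sum_pair hn.symm]
      simp [hd, hn, hn.symm]
    · intro k hk
      simp only [Finset.mem_insert, Finset.mem_singleton, not_or] at hk
      simp [hd, hk.1, hk.2]
  rw [hd2, one_mul] at hmain
  refine le_trans ?_ hmain
  have hle := (parseval_summable _ hcs).summable.sum_le_tsum {0, n} (fun _ _ => by positivity)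
  rw [Finset.sum_pair hn.symm] at hle
  refine le_trans (le_of_eq ?_) hle
  simp [hb, hsh, hn]

theorem norm_zero_le {f : ℂ → ℂ} (hf : memB f) : ‖taylorCoeff f 0‖ ≤ 1 := by
  rw [taylorCoeff_zero]; exact hf.2 0 (by simp)

theorem coeff_bound {f : ℂ → ℂ} (hf : memB f) {n : ℕ} (hn : n ≠ 0) :
    ‖taylorCoeff f n‖ ≤ 1 - ‖taylorCoeff f 0‖ ^ 2 := by
  have hA := norm_zero_le hf
  have hA0 := norm_nonneg (taylorCoeff f 0)
  have key : ∀ s : ℝ, 0 ≤ s → s < 1 →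
      ‖taylorCoeff f n‖ * s ^ n ≤ 1 - ‖taylorCoeff f 0‖ ^ 2 := by
    intro s hs0 hs
    have hnb : ‖taylorCoeff f n * (s : ℂ) ^ n‖ = ‖taylorCoeff f n‖ * s ^ n := by
      simp [abs_of_nonneg hs0]
    rw [← hnb]
    have H := coeff_bound_aux hf hs0 hs hn
    generalize taylorCoeff f n * (s : ℂ) ^ n = b at *
    generalize taylorCoeff f 0 = a at *
    rcases hA.lt_or_eq with h1 | h1
    · have hu : 0 < 1 - ‖a‖ ^ 2 := by nlinarith
      have huc : (1 - (‖a‖ : ℂ) ^ 2) ≠ 0 := by exact_mod_cast hu.ne'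
      have h2 := H (b * (starRingEnd ℂ) a / (1 - (‖a‖ : ℂ) ^ 2))
      have h3 : b + b * (starRingEnd ℂ) a / (1 - (‖a‖ : ℂ) ^ 2) * a
          = b / (1 - (‖a‖ : ℂ) ^ 2) := by
        have h4 : (starRingEnd ℂ) a * a = (‖a‖ : ℂ) ^ 2 := Complex.conj_mul' a
        field_simp
        linear_combination b * h4
      have h5 : ‖(1 - (‖a‖ : ℂ) ^ 2)‖ = 1 - ‖a‖ ^ 2 := by
        have : (1 - (‖a‖ : ℂ) ^ 2) = ((1 - ‖a‖ ^ 2 : ℝ) : ℂ) := by push_cast; ring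
        rw [this, Complex.norm_real, Real.norm_of_nonneg hu.le]
      rw [h3, norm_div, norm_div, norm_mul, h5, RCLike.norm_conj, div_pow, div_pow] at h2
      refine le_of_sq_le_sq ?_ hu.le
      have h6 : ‖b‖ ^ 2 / (1 - ‖a‖ ^ 2) ≤ 1 - ‖a‖ ^ 2 := by
        have : ‖b‖ ^ 2 / (1 - ‖a‖ ^ 2) = ‖b‖ ^ 2 / (1 - ‖a‖ ^ 2) ^ 2
            - (‖b‖ * ‖a‖) ^ 2 / (1 - ‖a‖ ^ 2) ^ 2 := by
          field_simp
          
        rw [this]; linarith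
      rw [div_le_iff₀ hu] at h6
      nlinarith
    · have h2 := H 0
      rw [h1] at h2 ⊢
      simp at h2
      simp [h2]
  have hlim : Tendsto (fun s : ℝ => ‖taylorCoeff f n‖ * s ^ n) (𝓝[<] 1)
      (𝓝 (‖taylorCoeff f n‖ * 1 ^ n)) := by
    refine tendsto_nhdsWithin_of_tendsto_nhds ?_
    exact Continuous.tendsto (by fun_prop) 1
  rw [one_pow, mul_one] at hlim
  refine le_of_tendsto hlim ?_
  filter_upwards [Ioo_mem_nhdsLT (zero_lt_one' ℝ)] with s hs
  exact key s hs.1.le hs.2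

theorem schwarz_pick_zero {f : ℂ → ℂ} (hf : memB f) (h0 : ‖f 0‖ < 1) {z : ℂ} (hz : ‖z‖ < 1) :
    ‖f z - f 0‖ ≤ ‖z‖ * ‖1 - (starRingEnd ℂ) (f 0) * f z‖ := by
  have hne : ∀ w : ℂ, ‖w‖ < 1 → 1 - (starRingEnd ℂ) (f 0) * f w ≠ 0 := by
    intro w hw h
    have h1 : ‖(starRingEnd ℂ) (f 0) * f w‖ = 1 := by
      rw [← sub_eq_zero.1 h, norm_one]
    rw [norm_mul, RCLike.norm_conj] at h1
    have := hf.2 w (by simpa using hw)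
    nlinarith [norm_nonneg (f 0), norm_nonneg (f w)]
  have hle : ∀ w : ℂ, ‖w‖ < 1 → ‖f w - f 0‖ ≤ ‖1 - (starRingEnd ℂ) (f 0) * f w‖ := by
    intro w hw
    have h1 := hf.2 w (by simpa using hw)
    refine le_of_sq_le_sq ?_ (norm_nonneg _)
    have h2 : ‖1 - (starRingEnd ℂ) (f 0) * f w‖ ^ 2 - ‖f w - f 0‖ ^ 2 =
        (1 - ‖f 0‖ ^ 2) * (1 - ‖f w‖ ^ 2) := by
      simp only [Complex.sq_norm, Complex.normSq_apply, Complex.sub_re, Complex.sub_im,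
        Complex.mul_re, Complex.mul_im, Complex.conj_re, Complex.conj_im, Complex.one_re,
        Complex.one_im]
      ring
    have h3 : 0 ≤ (1 - ‖f 0‖ ^ 2) * (1 - ‖f w‖ ^ 2) :=
      mul_nonneg (by nlinarith [norm_nonneg (f 0)]) (by nlinarith [norm_nonneg (f w)])
    linarith
  have hs := Complex.norm_le_norm_of_mapsTo_ball (R := 1) (z := z)
    (f := fun w => (f w - f 0) / (1 - (starRingEnd ℂ) (f 0) * f w)) ?_ ?_ (by simp) hz
  · simp only [norm_div] at hs
    rwa [div_le_iff₀ (norm_pos_iff.2 (hne z hz))] at hs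
  · refine DifferentiableOn.div (hf.1.sub_const _) ((hf.1.const_mul _).const_sub _) ?_
    intro w hw
    exact hne w (by simpa using hw)
  · intro w hw
    have hw' : ‖w‖ < 1 := by simpa using hw
    simp only [mem_closedBall, dist_zero_right, norm_div]
    exact div_le_one_of_le₀ (hle w hw') (norm_nonneg _)

theorem l2_tail {f : ℂ → ℂ} (hf : memB f) (h0 : ‖taylorCoeff f 0‖ < 1) {s : ℝ} (hs0 : 0 ≤ s)
    (hs : s < 1) :
    Summable (fun n => (‖taylorCoeff f (n + 1)‖ * s ^ (n + 1)) ^ 2) ∧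
    ∑' n, (‖taylorCoeff f (n + 1)‖ * s ^ (n + 1)) ^ 2 ≤
      s ^ 2 * ((1 - ‖taylorCoeff f 0‖ ^ 2) ^ 2 + ‖taylorCoeff f 0‖ ^ 2 *
        ∑' n, (‖taylorCoeff f (n + 1)‖ * s ^ (n + 1)) ^ 2) := by
  set a := taylorCoeff f 0 with ha
  have haf : f 0 = a := (taylorCoeff_zero f).symm
  set b : ℕ → ℂ := fun k => taylorCoeff f k * s ^ k with hb
  have hbn : ∀ k, ‖b k‖ = ‖taylorCoeff f k‖ * s ^ k := by
    intro k; simp [hb, abs_of_nonneg hs0]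
  have hbs : Summable fun k => ‖b k‖ := by
    simpa only [hbn] using summable_taylorCoeff hf.1 hs0 hs
  have hbw : ∀ w : ℂ, ‖w‖ = 1 → HasSum (fun k => b k * w ^ k) (f (s * w)) := by
    intro w hw
    have := hasSum_taylorCoeff hf.1 (z := s * w) (by simpa [hw, abs_of_nonneg hs0] using hs)
    convert! this using 1
    funext k
    simp only [hb, mul_pow]; ring
  have hite : ∀ x w : ℂ, HasSum (fun k : ℕ => (if k = 0 then x else 0) * w ^ k) x := by
    intro x w
    convert! hasSum_single (f := fun k : ℕ => (if k = 0 then x else 0) * w ^ k) 0 ?_ using 1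
    · simp
    · intro k hk; simp [hk]
  have hites : ∀ x : ℂ, Summable fun k : ℕ => ‖(if k = 0 then x else 0 : ℂ)‖ := by
    intro x
    refine summable_of_ne_finset_zero (s := {0}) fun k hk => ?_
    simp only [Finset.mem_singleton] at hk
    simp [hk]
  set c : ℕ → ℂ := fun k => b k - (if k = 0 then a else 0) with hc
  set d : ℕ → ℂ := fun k => (if k = 0 then 1 else 0) - (starRingEnd ℂ) a * b k with hd
  have hcs : Summable fun k => ‖c k‖ :=
    Summable.of_nonneg_of_le (fun _ => norm_nonneg _) (fun k => norm_sub_le _ _)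
      (hbs.add (hites a))
  have hds : Summable fun k => ‖d k‖ := by
    refine Summable.of_nonneg_of_le (fun _ => norm_nonneg _) (fun k => norm_sub_le _ _)
      ((hites 1).add ?_)
    simpa using hbs.mul_left ‖a‖
  have hcw : ∀ w : ℂ, ‖w‖ = 1 → ∑' k, c k * w ^ k = f (s * w) - a := by
    intro w hw
    refine HasSum.tsum_eq ?_
    convert! (hbw w hw).sub (hite a w) using 1
    funext k; simp only [hc]; ring
  have hdw : ∀ w : ℂ, ‖w‖ = 1 → ∑' k, d k * w ^ k = 1 - (starRingEnd ℂ) a * f (s * w) := by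
    intro w hw
    refine HasSum.tsum_eq ?_
    convert! (hite 1 w).sub ((hbw w hw).mul_left ((starRingEnd ℂ) a)) using 1
    funext k; simp only [hd]; ring
  have hmain := l2_compare c d hcs hds (s ^ 2) (by
    intro w hw
    rw [hcw w hw, hdw w hw, ← mul_pow]
    refine pow_le_pow_left₀ (norm_nonneg _) ?_ 2
    have := schwarz_pick_zero hf (by rwa [haf]) (z := s * w)
      (by simpa [hw, abs_of_nonneg hs0] using hs)
    rw [haf] at this
    simpa [hw, abs_of_nonneg hs0] using this)
  have hc2 := (parseval_summable c hcs).summable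
  have hd2 := (parseval_summable d hds).summable
  rw [hc2.tsum_eq_zero_add, hd2.tsum_eq_zero_add] at hmain
  have ec0 : ‖c 0‖ ^ 2 = 0 := by simp [hc, hb, ha]
  have ed0 : ‖d 0‖ ^ 2 = (1 - ‖a‖ ^ 2) ^ 2 := by
    have h4 : (starRingEnd ℂ) a * a = (‖a‖ : ℂ) ^ 2 := Complex.conj_mul' a
    have : d 0 = ((1 - ‖a‖ ^ 2 : ℝ) : ℂ) := by
      simp only [hd, hb, if_true, pow_zero, mul_one, ← ha, h4]; push_cast; ring
    rw [this, Complex.norm_real, Real.norm_eq_abs, sq_abs]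
  have ec : ∀ k, ‖c (k + 1)‖ ^ 2 = (‖taylorCoeff f (k + 1)‖ * s ^ (k + 1)) ^ 2 := by
    intro k; rw [← hbn]; simp [hc]
  have ed : ∀ k, ‖d (k + 1)‖ ^ 2 = ‖a‖ ^ 2 * (‖taylorCoeff f (k + 1)‖ * s ^ (k + 1)) ^ 2 := by
    intro k; rw [← hbn]; simp [hd, mul_pow]
  have hsum := (summable_nat_add_iff 1).2 hc2
  simp only [ec] at hsum
  simp only [ec, ed, ec0, ed0, tsum_mul_left, zero_add] at hmain
  exact ⟨hsum, hmain⟩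

theorem bohr_sharp {f : ℂ → ℂ} (hf : memB f) (hA1 : ‖taylorCoeff f 0‖ < 1)
    (hA3 : 1 / 3 < ‖taylorCoeff f 0‖) :
    ∑' n, ‖taylorCoeff f (n + 1)‖ * (1 / 3 : ℝ) ^ (n + 1) ≤
      (1 - ‖taylorCoeff f 0‖ ^ 2) / (3 - ‖taylorCoeff f 0‖) := by
  have L := fun s hs0 hs => l2_tail hf hA1 (s := s) hs0 hs
  set A := ‖taylorCoeff f 0‖
  have hA0 : 0 < A := by linarith
  set s := Real.sqrt (1 / (3 * A)) with hsdef
  have hs2 : s ^ 2 = 1 / (3 * A) := Real.sq_sqrt (by positivity)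
  have hspos : 0 < s := Real.sqrt_pos.2 (by positivity)
  have hs1 : s < 1 := by
    have : s ^ 2 < 1 := by
      rw [hs2, div_lt_one (by positivity)]; linarith
    nlinarith
  obtain ⟨hsum, hX⟩ := L s hspos.le hs1
  set X := ∑' n, (‖taylorCoeff f (n + 1)‖ * s ^ (n + 1)) ^ 2
  set t := 1 / (3 * s) with ht
  have ht2 : t ^ 2 = A / 3 := by
    rw [ht, div_pow, mul_pow, hs2]; field_simp
  have hst : s * t = 1 / 3 := by rw [ht]; field_simp
  have htpos : 0 < t := by positivity
  have hu : 0 < 1 - A ^ 2 := by nlinarith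
  have hgeo : HasSum (fun n : ℕ => (t ^ (n + 1)) ^ 2) (A / (3 - A)) := by
    have h := (hasSum_geometric_of_lt_one (r := A / 3) (by positivity) (by linarith)).mul_left
      (A / 3)
    convert! h using 1
    · funext n
      rw [← pow_mul, mul_comm (n + 1) 2, pow_mul, ht2, pow_succ]; ring
    · have : (3 - A) ≠ 0 := by linarith
      field_simp
  have hXle : X ≤ (1 - A ^ 2) ^ 2 / (A * (3 - A)) := by
    rw [hs2] at hX
    rw [le_div_iff₀ (by nlinarith)]
    have : X * (3 * A) ≤ (1 - A ^ 2) ^ 2 + A ^ 2 * X := by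
      rw [one_div_mul_eq_div, le_div_iff₀ (by positivity)] at hX
      exact hX
    nlinarith
  have hterm : ∀ n, ‖taylorCoeff f (n + 1)‖ * (1 / 3 : ℝ) ^ (n + 1) ≤
      A / (1 - A ^ 2) / 2 * (‖taylorCoeff f (n + 1)‖ * s ^ (n + 1)) ^ 2 +
      (1 - A ^ 2) / A / 2 * (t ^ (n + 1)) ^ 2 := by
    intro n
    rw [← hst, mul_pow]
    set p := ‖taylorCoeff f (n + 1)‖ * s ^ (n + 1)
    set q := t ^ (n + 1)
    have hk : 0 < A / (1 - A ^ 2) := by positivity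
    have e : (1 - A ^ 2) / A = (A / (1 - A ^ 2))⁻¹ := by rw [inv_div]
    rw [e, ← mul_assoc]
    change p * q ≤ _
    generalize A / (1 - A ^ 2) = k at hk
    have : 0 ≤ (k * p - q) ^ 2 / (2 * k) := by positivity
    have e2 : (k * p - q) ^ 2 / (2 * k) = k / 2 * p ^ 2 + k⁻¹ / 2 * q ^ 2 - p * q := by
      field_simp; ring
    linarith
  have hR := (hsum.hasSum.mul_left (A / (1 - A ^ 2) / 2)).add
    (hgeo.mul_left ((1 - A ^ 2) / A / 2))
  have hL : Summable fun n => ‖taylorCoeff f (n + 1)‖ * (1 / 3 : ℝ) ^ (n + 1) :=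
    (summable_nat_add_iff (f := fun n => ‖taylorCoeff f n‖ * (1 / 3 : ℝ) ^ n) 1).2
      (summable_taylorCoeff hf.1 (by norm_num) (by norm_num))
  have h1 := hasSum_le hterm hL.hasSum hR
  refine h1.trans ?_
  have h2 : A / (1 - A ^ 2) / 2 * X ≤
      A / (1 - A ^ 2) / 2 * ((1 - A ^ 2) ^ 2 / (A * (3 - A))) := by gcongr
  refine (add_le_add_left h2 _).trans (le_of_eq ?_)
  have : (3 - A) ≠ 0 := by linarith
  field_simp
  ring

theorem phi0_eq (f : ℂ → ℂ) (r : ℝ) (σ : ℝ)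
    (h : ∑' n : ℕ, (n : ℝ) * ‖taylorCoeff f n‖ ^ 2 * r ^ (2 * n) = σ) :
    phi0 f r = σ / (1 - σ) := by
  have hpi := Real.pi_pos.ne'
  rw [phi0, Sarea, h, show Real.pi - Real.pi * σ = Real.pi * (1 - σ) by ring,
    mul_div_mul_left _ _ hpi]

theorem sigma_bound {f : ℂ → ℂ} (hf : memB f) {r : ℝ} (hr0 : 0 ≤ r) (hr : r ≤ 1 / 3) :
    ∑' n : ℕ, (n : ℝ) * ‖taylorCoeff f n‖ ^ 2 * r ^ (2 * n) ≤
      (1 - ‖taylorCoeff f 0‖ ^ 2) ^ 2 * (r ^ 2 / (1 - r ^ 2) ^ 2) := by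
  have hx : ‖r ^ 2‖ < 1 := by
    rw [Real.norm_of_nonneg (by positivity)]; nlinarith
  have hg := (hasSum_coe_mul_geometric_of_norm_lt_one hx).mul_left
    ((1 - ‖taylorCoeff f 0‖ ^ 2) ^ 2)
  have hle : ∀ n : ℕ, (n : ℝ) * ‖taylorCoeff f n‖ ^ 2 * r ^ (2 * n) ≤
      (1 - ‖taylorCoeff f 0‖ ^ 2) ^ 2 * (n * (r ^ 2) ^ n) := by
    intro n
    rcases eq_or_ne n 0 with rfl | hn
    · simp
    · have h1 := pow_le_pow_left₀ (norm_nonneg _) (coeff_bound hf hn) 2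
      rw [pow_mul]
      have h2 : 0 ≤ (n : ℝ) * (r ^ 2) ^ n := by positivity
      nlinarith
  have hs : Summable fun n : ℕ => (n : ℝ) * ‖taylorCoeff f n‖ ^ 2 * r ^ (2 * n) :=
    Summable.of_nonneg_of_le (fun n => by positivity) hle hg.summable
  exact hasSum_le hle hs.hasSum hg

theorem bohr_le {f : ℂ → ℂ} (hf : memB f) {r : ℝ} (hr0 : 0 ≤ r) (hr : r ≤ 1 / 3) :
    bohrSum f r ≤ ‖taylorCoeff f 0‖ +
      ∑' n, ‖taylorCoeff f (n + 1)‖ * (1 / 3 : ℝ) ^ (n + 1) := by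
  have h1 := summable_taylorCoeff hf.1 hr0 (by linarith)
  have h2 := summable_taylorCoeff hf.1 (s := 1 / 3) (by norm_num) (by norm_num)
  rw [bohrSum, h1.tsum_eq_zero_add, pow_zero, mul_one]
  have h3 := (summable_nat_add_iff 1).2 h1
  have h4 := (summable_nat_add_iff 1).2 h2
  refine add_le_add_right (h3.tsum_le_tsum (fun n => ?_) h4) _
  gcongr

theorem tail_crude {f : ℂ → ℂ} (hf : memB f) :
    ∑' n, ‖taylorCoeff f (n + 1)‖ * (1 / 3 : ℝ) ^ (n + 1) ≤ (1 - ‖taylorCoeff f 0‖ ^ 2) / 2 := by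
  have h2 := (summable_nat_add_iff 1).2
    (summable_taylorCoeff hf.1 (s := 1 / 3) (by norm_num) (by norm_num))
  have hg := (hasSum_geometric_of_lt_one (r := (1 / 3 : ℝ)) (by norm_num) (by norm_num)).mul_left
    ((1 - ‖taylorCoeff f 0‖ ^ 2) / 3)
  have h := hasSum_le (fun n => ?_) h2.hasSum hg
  · refine h.trans (le_of_eq ?_)
    norm_num; ring
  · have := coeff_bound hf (Nat.succ_ne_zero n)
    rw [pow_succ]
    have hp : 0 ≤ (1 / 3 : ℝ) ^ n := by positivity
    nlinarith

theorem bohr_final {f : ℂ → ℂ} (hf : memB f) {r : ℝ} (hr0 : 0 ≤ r) (hr : r ≤ 1 / 3) :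
    bohrSum f r + 16 * (1 - ‖taylorCoeff f 0‖ ^ 2) ^ 2 /
      (64 - 9 * (1 - ‖taylorCoeff f 0‖ ^ 2) ^ 2) ≤ 1 := by
  have hb := bohr_le hf hr0 hr
  have hc := tail_crude hf
  have hs := bohr_sharp hf
  have hA := norm_zero_le hf
  have hA0 := norm_nonneg (taylorCoeff f 0)
  generalize ‖taylorCoeff f 0‖ = A at *
  generalize ∑' n, ‖taylorCoeff f (n + 1)‖ * (1 / 3 : ℝ) ^ (n + 1) = T at *
  have hu0 : 0 ≤ 1 - A ^ 2 := by nlinarith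
  have hu1 : 1 - A ^ 2 ≤ 1 := by nlinarith
  have hden : 0 < 64 - 9 * (1 - A ^ 2) ^ 2 := by nlinarith
  rcases hA.lt_or_eq with h1 | h1
  · rcases le_or_gt A (1 / 3) with h3 | h3
    · have : 16 * (1 - A ^ 2) ^ 2 / (64 - 9 * (1 - A ^ 2) ^ 2) ≤ (1 - A) ^ 2 / 2 := by
        rw [div_le_iff₀ hden]
        have e : (1 - A) ^ 2 / 2 * (64 - 9 * (1 - A ^ 2) ^ 2) - 16 * (1 - A ^ 2) ^ 2 =
          (1 - A) ^ 2 / 2 * ((1 - 3 * A) * (23 + 5 * A + A ^ 2 + 3 * A ^ 3)) := by ring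
        have : 0 ≤ (1 - A) ^ 2 / 2 * ((1 - 3 * A) * (23 + 5 * A + A ^ 2 + 3 * A ^ 3)) :=
          mul_nonneg (by positivity) (mul_nonneg (by linarith) (by positivity))
        linarith
      nlinarith
    · have hs' := hs h1 h3
      have h3A : 0 < 3 - A := by linarith
      have : 16 * (1 - A ^ 2) ^ 2 / (64 - 9 * (1 - A ^ 2) ^ 2) ≤ 2 * (1 - A) ^ 2 / (3 - A) := by
        rw [div_le_div_iff₀ hden h3A]
        have e : 2 * (1 - A) ^ 2 * (64 - 9 * (1 - A ^ 2) ^ 2) - 16 * (1 - A ^ 2) ^ 2 * (3 - A) =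
          2 * (1 - A) ^ 2 * ((1 - A) * ((31 - 9 * A) + A ^ 2 + 9 * A ^ 3)) := by ring
        have : 0 ≤ 2 * (1 - A) ^ 2 * ((1 - A) * ((31 - 9 * A) + A ^ 2 + 9 * A ^ 3)) := by
          have : 0 ≤ 31 - 9 * A := by linarith
          exact mul_nonneg (by positivity) (mul_nonneg (by linarith) (by positivity))
        linarith
      have e2 : A + (1 - A ^ 2) / (3 - A) + 2 * (1 - A) ^ 2 / (3 - A) = 1 := by
        field_simp; ring
      linarith
  · subst h1
    norm_num at hc ⊢
    linarith

theorem lower_mem (R : ℝ) (hR0 : 0 < R) (hR : R ≤ 1 / 3) {f : ℂ → ℂ} (hf : memB f) {r : ℝ}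
    (hr0 : 0 ≤ r) (hrR : r ≤ R) :
    bohrSum f r + 2 / 9 * ((1 - R ^ 2) / R ^ 2) * phi0 f r ≤ 1 := by
  have hr : r ≤ 1 / 3 := hrR.trans hR
  have hB := bohr_final hf hr0 hr
  have hσ := sigma_bound hf hr0 hr
  have hσ0 : 0 ≤ ∑' n : ℕ, (n : ℝ) * ‖taylorCoeff f n‖ ^ 2 * r ^ (2 * n) :=
    tsum_nonneg fun n => by positivity
  rw [phi0_eq f r _ rfl]
  have hA := norm_zero_le hf
  have hA0 := norm_nonneg (taylorCoeff f 0)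
  generalize ∑' n : ℕ, (n : ℝ) * ‖taylorCoeff f n‖ ^ 2 * r ^ (2 * n) = σ at *
  generalize ‖taylorCoeff f 0‖ = A at *
  have hu0 : 0 ≤ 1 - A ^ 2 := by nlinarith
  have hu1 : 1 - A ^ 2 ≤ 1 := by nlinarith
  generalize 1 - A ^ 2 = u at *
  have hu2 : u ^ 2 ≤ 1 := by nlinarith
  have hu20 : 0 ≤ u ^ 2 := by positivity
  have hden : 0 < 64 - 9 * u ^ 2 := by nlinarith
  have hx : r ^ 2 ≤ 1 / 9 := by nlinarith
  have hx0 : 0 ≤ r ^ 2 := by positivity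
  have hxX : r ^ 2 ≤ R ^ 2 := by nlinarith
  have hX : R ^ 2 ≤ 1 / 9 := by nlinarith
  have hX0 : 0 < R ^ 2 := by positivity
  generalize r ^ 2 = x at *
  generalize R ^ 2 = X at *
  -- bounds on σ
  have h1x : 0 < 1 - x := by linarith
  have hs1 : σ * (1 - x) ^ 2 ≤ u ^ 2 * x := by
    rw [← mul_div_assoc, le_div_iff₀ (by positivity)] at hσ
    exact hσ
  have hs2 : σ ≤ 9 * u ^ 2 / 64 := by
    refine hσ.trans ?_
    have : x / (1 - x) ^ 2 ≤ 9 / 64 := by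
      rw [div_le_div_iff₀ (by positivity) (by norm_num)]
      nlinarith
    nlinarith
  have hs3 : 2 / 9 * ((1 - X) / X) * σ ≤ u ^ 2 / 4 := by
    have e1 : (1 - X) / X * σ ≤ 9 / 8 * u ^ 2 := by
      rw [div_mul_eq_mul_div, div_le_iff₀ hX0]
      -- σ(1-X) ≤ σ(1-x) ≤ u²x/(1-x) ≤ 9/8 u² X
      have a1 : σ * (1 - x) ≤ 9 / 8 * u ^ 2 * x := by
        have : σ * (1 - x) * (8 / 9) ≤ σ * (1 - x) * (1 - x) :=
          mul_le_mul_of_nonneg_left (by linarith) (by positivity)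
        nlinarith
      have a2 : u ^ 2 * x ≤ u ^ 2 * X := mul_le_mul_of_nonneg_left hxX hu20
      have a3 : σ * x ≤ σ * X := mul_le_mul_of_nonneg_left hxX hσ0
      nlinarith
    linarith
  have hpos : 0 < 1 - σ := by linarith
  have hfin : 2 / 9 * ((1 - X) / X) * (σ / (1 - σ)) ≤ 16 * u ^ 2 / (64 - 9 * u ^ 2) := by
    rw [← mul_div_assoc, div_le_div_iff₀ hpos hden]
    calc _ ≤ u ^ 2 / 4 * (64 - 9 * u ^ 2) := mul_le_mul_of_nonneg_right hs3 hden.le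
      _ = 16 * u ^ 2 * (1 - 9 * u ^ 2 / 64) := by ring
      _ ≤ _ := mul_le_mul_of_nonneg_left (by linarith) (by positivity)
  linarith

/-- The extremal Moebius map with `a = 1/3`. -/
noncomputable def moeb (z : ℂ) : ℂ := (1 / 3 - z) / (1 - z / 3)

theorem moeb_den {z : ℂ} (hz : ‖z‖ < 1) : 1 - z / 3 ≠ 0 := by
  intro h
  have h1 : z = 3 := by linear_combination -3 * h
  rw [h1] at hz
  norm_num at hz

theorem moeb_memB : memB moeb := by
  constructor
  · refine DifferentiableOn.div (by fun_prop) (by fun_prop) ?_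
    intro z hz
    exact moeb_den (by simpa using hz)
  · intro z hz
    have hz' : ‖z‖ < 1 := by simpa using hz
    rw [moeb, norm_div]
    refine div_le_one_of_le₀ ?_ (norm_nonneg _)
    refine le_of_sq_le_sq ?_ (norm_nonneg _)
    have h2 : ‖1 - z / 3‖ ^ 2 - ‖1 / 3 - z‖ ^ 2 = 8 / 9 * (1 - ‖z‖ ^ 2) := by
      rw [show z / 3 = ((1 / 3 : ℝ) : ℂ) * z by push_cast; ring,
        show (1 / 3 : ℂ) = ((1 / 3 : ℝ) : ℂ) by push_cast; ring]
      simp only [Complex.sq_norm, Complex.normSq_apply, Complex.sub_re, Complex.sub_im,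
        Complex.mul_re, Complex.mul_im, Complex.ofReal_re, Complex.ofReal_im, Complex.one_re,
        Complex.one_im]
      ring
    have : ‖z‖ ^ 2 ≤ 1 := by nlinarith [norm_nonneg z]
    linarith

theorem moeb_coeff (n : ℕ) :
    taylorCoeff moeb n = if n = 0 then 1 / 3 else -(8 / 3) * (1 / 3) ^ n := by
  refine taylorCoeff_eq moeb_memB.1 (fun n => if n = 0 then 1 / 3 else -(8 / 3) * (1 / 3) ^ n) ?_ n
  intro z hz
  rw [← hasSum_nat_add_iff' 1]
  have hz3 : ‖z / 3‖ < 1 := by rw [norm_div]; norm_num; linarith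
  have h := (hasSum_geometric_of_norm_lt_one hz3).mul_left (-(8 / 9) * z)
  have hd := moeb_den hz
  have hd3 : 3 - z ≠ 0 := fun h => hd (by linear_combination h / 3)
  convert! h using 1
  · funext n
    simp only [Nat.succ_ne_zero, if_false, div_pow]
    field_simp
    ring
  · simp only [Finset.range_one, Finset.sum_singleton, if_true, pow_zero, mul_one, moeb]
    field_simp
    ring

theorem moeb_norm_coeff (n : ℕ) :
    ‖taylorCoeff moeb (n + 1)‖ = 8 / 3 * (1 / 3) ^ (n + 1) := by
  rw [moeb_coeff, if_neg (Nat.succ_ne_zero n)]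
  simp

theorem moeb_bohr {R : ℝ} (hR0 : 0 < R) (hR : R ≤ 1 / 3) :
    bohrSum moeb R = 1 / 3 + 8 * R / (3 * (3 - R)) := by
  have hs := summable_taylorCoeff moeb_memB.1 hR0.le (by linarith)
  rw [bohrSum, hs.tsum_eq_zero_add]
  congr 1
  · rw [moeb_coeff]; simp
  · have h := (hasSum_geometric_of_lt_one (r := R / 3) (by positivity) (by linarith)).mul_left
      (8 / 9 * R)
    have e : ∀ n : ℕ, ‖taylorCoeff moeb (n + 1)‖ * R ^ (n + 1) = 8 / 9 * R * (R / 3) ^ n := by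
      intro n
      rw [moeb_norm_coeff, div_pow, div_pow, pow_succ, pow_succ, one_pow]
      field_simp
      ring
    simp_rw [e]
    rw [h.tsum_eq]
    have : 3 - R ≠ 0 := by linarith
    have : 1 - R / 3 ≠ 0 := by linarith
    field_simp
    ring

theorem moeb_phi {R : ℝ} (hR0 : 0 < R) (hR : R ≤ 1 / 3) :
    phi0 moeb R = 64 * R ^ 2 / ((1 - R ^ 2) * (81 - R ^ 2)) := by
  have hR2 : R ^ 2 ≤ 1 / 9 := by nlinarith
  have hy : ‖R ^ 2 / 9‖ < 1 := by
    rw [Real.norm_of_nonneg (by positivity)]; linarith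
  have h := (hasSum_coe_mul_geometric_of_norm_lt_one hy).mul_left (64 / 9)
  have e : ∀ n : ℕ, (n : ℝ) * ‖taylorCoeff moeb n‖ ^ 2 * R ^ (2 * n) =
      64 / 9 * (n * (R ^ 2 / 9) ^ n) := by
    intro n
    cases n with
    | zero => simp
    | succ n =>
      rw [moeb_norm_coeff, pow_mul, div_pow (R ^ 2), mul_pow, ← pow_mul, mul_comm (n + 1) 2,
        pow_mul (1 / 3 : ℝ), show ((1 / 3 : ℝ) ^ 2) = 1 / 9 by norm_num, div_pow 1, one_pow]
      ring
  have hσ : ∑' n : ℕ, (n : ℝ) * ‖taylorCoeff moeb n‖ ^ 2 * R ^ (2 * n) =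
      64 * R ^ 2 / (9 - R ^ 2) ^ 2 := by
    simp_rw [e]
    rw [h.tsum_eq]
    have : 9 - R ^ 2 ≠ 0 := by linarith
    have : 1 - R ^ 2 / 9 ≠ 0 := by linarith
    field_simp
  rw [phi0_eq _ _ _ hσ]
  have h9 : 9 - R ^ 2 ≠ 0 := by linarith
  have h1 : 1 - R ^ 2 ≠ 0 := by linarith
  have h81 : 81 - R ^ 2 ≠ 0 := by linarith
  have h2 : 1 - 64 * R ^ 2 / (9 - R ^ 2) ^ 2 =
      (1 - R ^ 2) * (81 - R ^ 2) / (9 - R ^ 2) ^ 2 := by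
    field_simp; ring
  rw [h2]
  field_simp

theorem upper_mem (R : ℝ) (hR0 : 0 < R) (hR : R ≤ 1 / 3) {l : ℝ}
    (h : bohrSum moeb R + l * phi0 moeb R ≤ 1) :
    l ≤ 1 / 96 * ((81 - R ^ 2) * (3 - 5 * R) / (3 - R)) * ((1 - R ^ 2) / R ^ 2) := by
  rw [moeb_bohr hR0 hR, moeb_phi hR0 hR] at h
  have hR2 : R ^ 2 ≤ 1 / 9 := by nlinarith
  have h1 : 0 < 1 - R ^ 2 := by linarith
  have h81 : 0 < 81 - R ^ 2 := by linarith
  have h3 : 0 < 3 - R := by linarith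
  have hφ : 0 < 64 * R ^ 2 / ((1 - R ^ 2) * (81 - R ^ 2)) := by positivity
  have h4 : l * (64 * R ^ 2 / ((1 - R ^ 2) * (81 - R ^ 2))) ≤
      2 / 3 - 8 * R / (3 * (3 - R)) := by linarith
  rw [← le_div_iff₀ hφ] at h4
  refine h4.trans (le_of_eq ?_)
  field_simp
  ring

/-- For every `0 < R ≤ 1/3` the sharp constant `Λ_{φ₀}(R)` satisfies
`(2/9)((1−R²)/R²) ≤ Λ(R) ≤ (1/96)((81−R²)(3−5R)/(3−R))((1−R²)/R²)`. -/
theorem sharpConstant_bounds (R : ℝ) (hR0 : 0 < R) (hR : R ≤ 1 / 3) :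
    2 / 9 * ((1 - R ^ 2) / R ^ 2) ≤ sharpConstant phi0 R ∧
    sharpConstant phi0 R ≤
      1 / 96 * ((81 - R ^ 2) * (3 - 5 * R) / (3 - R)) * ((1 - R ^ 2) / R ^ 2) := by
  have hmem : 2 / 9 * ((1 - R ^ 2) / R ^ 2) ∈ {l : ℝ | 0 ≤ l ∧
      ∀ f, memB f → ∀ r, 0 ≤ r → r ≤ R → bohrSum f r + l * phi0 f r ≤ 1} := by
    refine ⟨?_, fun f hf r hr0 hr => lower_mem R hR0 hR hf hr0 hr⟩
    have : 0 ≤ 1 - R ^ 2 := by nlinarith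
    positivity
  have hub : ∀ l ∈ {l : ℝ | 0 ≤ l ∧
      ∀ f, memB f → ∀ r, 0 ≤ r → r ≤ R → bohrSum f r + l * phi0 f r ≤ 1},
      l ≤ 1 / 96 * ((81 - R ^ 2) * (3 - 5 * R) / (3 - R)) * ((1 - R ^ 2) / R ^ 2) :=
    fun l hl => upper_mem R hR0 hR (hl.2 moeb moeb_memB R hR0.le le_rfl)
  exact ⟨le_csSup ⟨_, hub⟩ hmem, csSup_le ⟨_, hmem⟩ hub⟩
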